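/- Assume the Bressan–Constantin differential relations (see context) and suppose W(ξ₇) = π, Z(ξ₇) = π, and Z′(ξ₇) = 0 at some point ξ₇ ∈ ℝ. Then ∂^i U(ξ₇) = 0 for i = 1, …, 5; ∂^j V(ξ₇) = 0 for j = 1, …, 4; ∂^6 U(ξ₇) = −(15/4) q(ξ₇) W′(ξ₇) Z″(ξ₇)²; ∂^5 V(ξ₇) = −(3/2) q(ξ₇) W′(ξ₇)² Z″(ξ₇); ∂^i y(ξ₇) = 0 for i = 1, …, 6; and ∂^7 y(ξ₇) = (45/4) q(ξ₇) W′(ξ₇)² Z″(ξ₇)². -/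

import Mathlib

open Real

/-- `f` is smooth, vanishes to order `n` at `x`, with `n`-th derivative `c`. -/
def VO (x : ℝ) (f : ℝ → ℝ) (n : ℕ) (c : ℝ) : Prop :=
  ContDiff ℝ (⊤ : ℕ∞) f ∧ (∀ i < n, iteratedDeriv i f x = 0) ∧ iteratedDeriv n f x = c

theorem VO.mul {x : ℝ} {f g : ℝ → ℝ} {n m : ℕ} {a b : ℝ} (hf : VO x f n a) (hg : VO x g m b) :
    VO x (fun t => f t * g t) (n + m) ((n + m).choose n * a * b) := by
  obtain ⟨f1, f2, f3⟩ := hf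
  obtain ⟨g1, g2, g3⟩ := hg
  have key : ∀ k, iteratedDeriv k (fun t => f t * g t) x = ∑ i ∈ Finset.range (k + 1),
      (k.choose i : ℝ) * iteratedDeriv i f x * iteratedDeriv (k - i) g x := by
    intro k
    exact iteratedDeriv_fun_mul (f1.contDiffAt.of_le (by exact_mod_cast le_top))
      (g1.contDiffAt.of_le (by exact_mod_cast le_top))
  refine ⟨f1.mul g1, ?_, ?_⟩
  · intro k hk
    rw [key]
    refine Finset.sum_eq_zero fun i hi => ?_
    have := Finset.mem_range.1 hi
    by_cases h : i < n
    · rw [f2 i h]; ring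
    · rw [g2 (k - i) (by omega)]; ring
  · rw [key, Finset.sum_eq_single n]
    · rw [f3, Nat.add_sub_cancel_left, g3]
    · intro i hi hne
      have := Finset.mem_range.1 hi
      by_cases h : i < n
      · rw [f2 i h]; ring
      · rw [g2 (n + m - i) (by omega)]; ring
    · intro h; exact absurd (Finset.mem_range.2 (by omega)) h

theorem VO.zero {x : ℝ} {f : ℝ → ℝ} (hf : ContDiff ℝ (⊤ : ℕ∞) f) : VO x f 0 (f x) :=
  ⟨hf, by simp, by simp⟩

theorem VO.succ {x : ℝ} {f g : ℝ → ℝ} {n : ℕ} {c : ℝ} (hf : ContDiff ℝ (⊤ : ℕ∞) f)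
    (h0 : f x = 0) (hd : deriv f = g) (h : VO x g n c) : VO x f (n + 1) c := by
  subst hd
  refine ⟨hf, ?_, by rw [iteratedDeriv_succ']; exact h.2.2⟩
  intro i hi
  cases i with
  | zero => simpa using h0
  | succ i => rw [iteratedDeriv_succ']; exact h.2.1 i (by omega)

theorem VO.fin {x : ℝ} {f g : ℝ → ℝ} {n : ℕ} {c : ℝ} (hd : deriv f = g) (h : VO x g n c) :
    (∀ i : ℕ, 1 ≤ i → i ≤ n → iteratedDeriv i f x = 0) ∧ iteratedDeriv (n + 1) f x = c := by
  subst hd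
  refine ⟨?_, by rw [iteratedDeriv_succ']; exact h.2.2⟩
  intro i h1 hi
  cases i with
  | zero => omega
  | succ i => rw [iteratedDeriv_succ']; exact h.2.1 i (by omega)

theorem smooth_deriv {f : ℝ → ℝ} (hf : ContDiff ℝ (⊤ : ℕ∞) f) :
    ContDiff ℝ (⊤ : ℕ∞) (deriv f) := (contDiff_infty_iff_deriv.1 hf).2

theorem VO.sin {x : ℝ} {f : ℝ → ℝ} {n : ℕ} {c : ℝ} (hf : ContDiff ℝ (⊤ : ℕ∞) f)
    (h0 : f x = π) (h : VO x (deriv f) n c) : VO x (fun t => Real.sin (f t)) (n + 1) (-c) := by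
  have hs : ContDiff ℝ (⊤ : ℕ∞) (fun t => Real.cos (f t)) := Real.contDiff_cos.comp hf
  have h2 := (VO.zero (x := x) hs).mul h
  have e : (((0 + n).choose 0 : ℕ) : ℝ) * Real.cos (f x) * c = -c := by simp [h0]
  rw [e, Nat.zero_add] at h2
  refine VO.succ (Real.contDiff_sin.comp hf) (by simp [h0]) ?_ h2
  funext t
  exact ((hf.differentiable (by simp) t).hasDerivAt.sin).deriv

theorem VO.cos {x : ℝ} {f : ℝ → ℝ} {n : ℕ} {c : ℝ} (hf : ContDiff ℝ (⊤ : ℕ∞) f)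
    (h0 : f x = π) (h : VO x (deriv f) n c) :
    VO x (fun t => Real.cos (f t / 2)) (n + 1) (-c / 2) := by
  have hs : ContDiff ℝ (⊤ : ℕ∞) (fun t => -Real.sin (f t / 2) / 2) :=
    ((Real.contDiff_sin.comp (hf.div_const 2)).neg).div_const 2
  have h2 := (VO.zero (x := x) hs).mul h
  have e : (((0 + n).choose 0 : ℕ) : ℝ) * (-Real.sin (f x / 2) / 2) * c = -c / 2 := by
    simp [h0]; ring
  rw [e, Nat.zero_add] at h2
  refine VO.succ (Real.contDiff_cos.comp (hf.div_const 2)) (by simp [h0]) ?_ h2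
  funext t
  rw [(((hf.differentiable (by simp) t).hasDerivAt.div_const 2).cos).deriv]
  ring


/-- Case (7) of the proof of Theorem 1.2: at a point `ξ₇` with
`W ξ₇ = π`, `Z ξ₇ = π` and `Z′ ξ₇ = 0`:
`∂^i U = 0` for `i = 1,…,5`, `∂^j V = 0` for `j = 1,…,4`,
`∂^6 U = -(15/4) q W′ (Z″)²`, `∂^5 V = -(3/2) q (W′)² Z″`,
`∂^i y = 0` for `i = 1,…,6`, and `∂^7 y = (45/4) q (W′)² (Z″)²` at `ξ₇`. -/
theorem stmt13 (q W Z U V y : ℝ → ℝ)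
    (hq : ContDiff ℝ (⊤ : ℕ∞) q) (hW : ContDiff ℝ (⊤ : ℕ∞) W) (hZ : ContDiff ℝ (⊤ : ℕ∞) Z)
    (hy : ∀ ξ, deriv y ξ = q ξ * Real.cos (W ξ / 2) ^ 2 * Real.cos (Z ξ / 2) ^ 2)
    (hU : ∀ ξ, deriv U ξ = q ξ / 2 * Real.sin (W ξ) * Real.cos (Z ξ / 2) ^ 2)
    (hV : ∀ ξ, deriv V ξ = q ξ / 2 * Real.cos (W ξ / 2) ^ 2 * Real.sin (Z ξ))
    (ξ₇ : ℝ) (hWπ : W ξ₇ = π) (hZπ : Z ξ₇ = π) (hZ' : deriv Z ξ₇ = 0) :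
    (∀ i : ℕ, 1 ≤ i → i ≤ 5 → iteratedDeriv i U ξ₇ = 0) ∧
    (∀ j : ℕ, 1 ≤ j → j ≤ 4 → iteratedDeriv j V ξ₇ = 0) ∧
    iteratedDeriv 6 U ξ₇
      = -(15 / 4) * q ξ₇ * deriv W ξ₇ * (iteratedDeriv 2 Z ξ₇) ^ 2 ∧
    iteratedDeriv 5 V ξ₇
      = -(3 / 2) * q ξ₇ * (deriv W ξ₇) ^ 2 * iteratedDeriv 2 Z ξ₇ ∧
    (∀ i : ℕ, 1 ≤ i → i ≤ 6 → iteratedDeriv i y ξ₇ = 0) ∧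
    iteratedDeriv 7 y ξ₇
      = (45 / 4) * q ξ₇ * (deriv W ξ₇) ^ 2 * (iteratedDeriv 2 Z ξ₇) ^ 2 := by
  have W1 : VO ξ₇ (deriv W) 0 (deriv W ξ₇) := VO.zero (smooth_deriv hW)
  have Z1 : VO ξ₇ (deriv Z) 1 (iteratedDeriv 2 Z ξ₇) := by
    refine VO.succ (n := 0) (smooth_deriv hZ) hZ' rfl ?_
    have := VO.zero (x := ξ₇) (smooth_deriv (smooth_deriv hZ))
    rwa [show iteratedDeriv 2 Z ξ₇ = deriv (deriv Z) ξ₇ by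
      rw [iteratedDeriv_succ, iteratedDeriv_one]]
  have sW := VO.sin hW hWπ W1
  have cW := VO.cos hW hWπ W1
  have sZ := VO.sin hZ hZπ Z1
  have cZ := VO.cos hZ hZπ Z1
  have q0 : VO ξ₇ q 0 (q ξ₇) := VO.zero hq
  have q2 : VO ξ₇ (fun t => q t / 2) 0 (q ξ₇ / 2) := VO.zero (hq.div_const 2)
  have c1 : Nat.choose 4 2 = 6 := by decide
  have c2 : Nat.choose 6 2 = 15 := by decide
  obtain ⟨y1, y2⟩ := VO.fin (f := y) (by funext t; rw [hy]; ring)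
    ((q0.mul (cW.mul cW)).mul (cZ.mul cZ))
  obtain ⟨u1, u2⟩ := VO.fin (f := U) (by funext t; rw [hU]; ring)
    ((q2.mul sW).mul (cZ.mul cZ))
  obtain ⟨v1, v2⟩ := VO.fin (f := V) (by funext t; rw [hV]; ring)
    ((q2.mul (cW.mul cW)).mul sZ)
  norm_num [c1, c2] at y1 y2 u1 u2 v1 v2
  refine ⟨u1, v1, ?_, ?_, y1, ?_⟩
  · rw [u2]; ring
  · rw [v2]; ring
  · rw [y2]; ring
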